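/- Let n > 2k and let B(y) = (1+ρ_{n,k}|y|²)^{-(n-2k)/2}. For l = 0, …, k−1, |Δ^{l/2}B(y)| = |P_l(|y|)|·(1+ρ_{n,k}|y|²)^{-(n-2k+2l)/2} for some polynomial P_l of degree l with nonzero leading coefficient, where Δ^{l/2}B means Δ^m B if l = 2m and ∇Δ^m B if l = 2m+1. In particular, there exists C ≥ 1 such that for T ≥ 2: C^{-1}·g(T) ≤ ∫_{B(0,T)} |Δ^{(k-1)/2}B|² dy ≤ C·g(T), where g(T) = T if n = 2k+1, g(T) = 1+log T if n = 2k+2, and g(T) = 1 if n ≥ 2k+3. -/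

import Mathlib

noncomputable section

open MeasureTheory Real

/-- The (geometer's, nonnegative) Euclidean Laplacian `Δ f = -∑ ∂ᵢ² f`. -/
def euclLap {n : ℕ} (f : EuclideanSpace ℝ (Fin n) → ℝ) (x : EuclideanSpace ℝ (Fin n)) : ℝ :=
  -∑ i : Fin n,
    iteratedFDeriv ℝ 2 f x ![EuclideanSpace.single i 1, EuclideanSpace.single i 1]

/-- The constant `ρ_{n,k} = (∏_{l=-k}^{k-1} (n+2l))^{-1/k}`. -/
def rhoNK (n k : ℕ) : ℝ :=
  (∏ j ∈ Finset.range (2 * k), ((n : ℝ) + 2 * j - 2 * k)) ^ (-(1 : ℝ) / k)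

/-- The standard Euclidean bubble `B(y) = (1 + ρ_{n,k}|y|²)^{-(n-2k)/2}`. -/
def bubble (n k : ℕ) (y : EuclideanSpace ℝ (Fin n)) : ℝ :=
  (1 + rhoNK n k * ‖y‖ ^ 2) ^ (-(((n : ℝ) - 2 * k) / 2))

/-- `|Δ^{l/2} B|`: `|Δ^m B|` for `l = 2m`, and `|∇ Δ^m B|` for `l = 2m+1`. -/
def halfLapNorm (n k : ℕ) (l : ℕ) (y : EuclideanSpace ℝ (Fin n)) : ℝ :=
  if Even l then |(euclLap^[l / 2] (bubble n k)) y|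
  else ‖fderiv ℝ (euclLap^[l / 2] (bubble n k)) y‖

open Polynomial in
/-- The derivative operator on the polynomial factor. -/
def Dop (ρ b : ℝ) (Q : Polynomial ℝ) : Polynomial ℝ :=
  derivative Q * (1 + C ρ * X) - C (b * ρ) * Q

/-- `Q(|y|²) (1+ρ|y|²)^{-b}`. -/
def Fqb {n : ℕ} (ρ b : ℝ) (Q : Polynomial ℝ) (y : EuclideanSpace ℝ (Fin n)) : ℝ :=
  Q.eval (‖y‖ ^ 2) * (1 + ρ * ‖y‖ ^ 2) ^ (-b)

open Polynomial in
def Lop (n : ℕ) (ρ b : ℝ) (Q : Polynomial ℝ) : Polynomial ℝ :=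
  -(C 4 * (X * Dop ρ (b + 1) (Dop ρ b Q)) + C (2 * (n : ℝ)) * (Dop ρ b Q * (1 + C ρ * X)))

lemma base_pos {ρ : ℝ} (hρ : 0 < ρ) {s : ℝ} (hs : 0 ≤ s) : 0 < 1 + ρ * s := by positivity

lemma hasDerivAt_h {ρ : ℝ} (hρ : 0 < ρ) (b : ℝ) (Q : Polynomial ℝ) {s : ℝ} (hs : 0 ≤ s) :
    HasDerivAt (fun s => Q.eval s * (1 + ρ * s) ^ (-b))
      ((Dop ρ b Q).eval s * (1 + ρ * s) ^ (-(b + 1))) s := by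
  have hp := base_pos hρ hs
  have h1 : HasDerivAt (fun s : ℝ => 1 + ρ * s) ρ s := by
    simpa using ((hasDerivAt_id s).const_mul ρ).const_add 1
  have h2 := h1.rpow_const (p := -b) (Or.inl hp.ne')
  have h3 := (Q.hasDerivAt s).mul h2
  refine h3.congr_deriv ?_
  have e1 : (1 + ρ * s) ^ (-b) = (1 + ρ * s) * (1 + ρ * s) ^ (-(b + 1)) := by
    have : -b = 1 + (-(b+1)) := by ring
    rw [this, Real.rpow_add hp, Real.rpow_one]
  have e2 : -b - 1 = -(b + 1) := by ring
  rw [e1, e2]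
  simp [Dop]
  ring

lemma hasFDerivAt_Fqb {n : ℕ} {ρ : ℝ} (hρ : 0 < ρ) (b : ℝ) (Q : Polynomial ℝ)
    (y : EuclideanSpace ℝ (Fin n)) :
    HasFDerivAt (Fqb ρ b Q) ((2 * Fqb ρ (b + 1) (Dop ρ b Q) y) • innerSL ℝ y) y := by
  have h1 : HasFDerivAt (fun y : EuclideanSpace ℝ (Fin n) => ‖y‖ ^ 2) (2 • innerSL ℝ y) y :=
    (hasStrictFDerivAt_norm_sq y).hasFDerivAt
  have h2 := (hasDerivAt_h hρ b Q (sq_nonneg ‖y‖)).comp_hasFDerivAt y h1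
  refine h2.congr_fderiv ?_
  ext v
  simp [Fqb]
  ring

lemma fderiv_Fqb {n : ℕ} {ρ : ℝ} (hρ : 0 < ρ) (b : ℝ) (Q : Polynomial ℝ) :
    fderiv ℝ (Fqb (n := n) ρ b Q) =
      fun y => (2 * Fqb ρ (b + 1) (Dop ρ b Q) y) • innerSL ℝ y :=
  funext fun y => (hasFDerivAt_Fqb hρ b Q y).fderiv

lemma euclLap_Fqb {n : ℕ} {ρ : ℝ} (hρ : 0 < ρ) (b : ℝ) (Q : Polynomial ℝ) :
    euclLap (Fqb (n := n) ρ b Q) = Fqb ρ (b + 2) (Lop n ρ b Q) := by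
  funext y
  have hp := base_pos hρ (sq_nonneg ‖y‖)
  have h2 : HasFDerivAt (fun y : EuclideanSpace ℝ (Fin n) =>
      (2 * Fqb ρ (b + 1) (Dop ρ b Q) y) • innerSL ℝ y) _ y :=
    ((hasFDerivAt_Fqb hρ (b+1) (Dop ρ b Q) y).const_mul 2).smul (innerSL ℝ).hasFDerivAt
  have key : ∀ i : Fin n, iteratedFDeriv ℝ 2 (Fqb ρ b Q) y
      ![EuclideanSpace.single i 1, EuclideanSpace.single i 1] =
      2 * Fqb ρ (b + 1) (Dop ρ b Q) y +
        4 * Fqb ρ (b + 1 + 1) (Dop ρ (b + 1) (Dop ρ b Q)) y * (y i) ^ 2 := by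
    intro i
    rw [iteratedFDeriv_two_apply, fderiv_Fqb hρ, h2.fderiv]
    have hone : (innerSL ℝ (EuclideanSpace.single i (1:ℝ))) (EuclideanSpace.single i (1:ℝ)) = 1 := by
      rw [innerSL_apply_apply]; simp
    simp [hone, EuclideanSpace.inner_single_right]
    ring
  unfold euclLap
  rw [Finset.sum_congr rfl (fun i _ => key i), Finset.sum_add_distrib, ← Finset.mul_sum, ← Finset.mul_sum]
  have hs : ∑ i : Fin n, (y i) ^ 2 = ‖y‖ ^ 2 := by
    rw [EuclideanSpace.real_norm_sq_eq]
  rw [hs]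
  have e1 : (1 + ρ * ‖y‖^2) ^ (-(b+1)) = (1 + ρ * ‖y‖^2) * (1 + ρ * ‖y‖^2) ^ (-(b + 2)) := by
    have : -(b+1) = 1 + (-(b+2)) := by ring
    rw [this, Real.rpow_add hp, Real.rpow_one]
  have e2 : b + 1 + 1 = b + 2 := by ring
  simp only [Fqb, e1, e2, Lop]
  simp
  ring

open Polynomial in
lemma Dop_deg (ρ b : ℝ) (Q : Polynomial ℝ) (m : ℕ) (hQ : Q.natDegree ≤ m) :
    (Dop ρ b Q).natDegree ≤ m ∧ (Dop ρ b Q).coeff m = ρ * (m - b) * Q.coeff m := by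
  have hc : ∀ j, (Dop ρ b Q).coeff j = Q.coeff (j + 1) * (j + 1) + ρ * (j - b) * Q.coeff j := by
    intro j
    have : Dop ρ b Q = derivative Q + C ρ * (derivative Q * X) - C (b * ρ) * Q := by
      unfold Dop; ring
    rw [this, coeff_sub, coeff_add, coeff_C_mul, coeff_C_mul]
    cases j with
    | zero => simp [coeff_derivative]; ring
    | succ j => simp [coeff_derivative, coeff_mul_X]; ring
  have hz : ∀ j, m < j → Q.coeff j = 0 := fun j hj =>
    coeff_eq_zero_of_natDegree_lt (lt_of_le_of_lt hQ hj)
  constructor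
  · rw [natDegree_le_iff_coeff_eq_zero]
    intro j hj
    rw [hc, hz j hj, hz (j+1) (by omega)]; ring
  · rw [hc, hz (m+1) (by omega)]; ring

open Polynomial in
lemma Lop_deg (n : ℕ) (ρ b : ℝ) (Q : Polynomial ℝ) (m : ℕ) (hQ : Q.natDegree ≤ m) :
    (Lop n ρ b Q).natDegree ≤ m + 1 ∧ (Lop n ρ b Q).coeff (m + 1)
      = -(ρ ^ 2 * (m - b) * (4 * (m - b - 1) + 2 * n) * Q.coeff m) := by
  obtain ⟨h1, h2⟩ := Dop_deg ρ b Q m hQ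
  obtain ⟨h3, h4⟩ := Dop_deg ρ (b + 1) (Dop ρ b Q) m h1
  have hc : ∀ j, (Lop n ρ b Q).coeff (j + 1) = -(4 * (Dop ρ (b + 1) (Dop ρ b Q)).coeff j +
      2 * n * ((Dop ρ b Q).coeff (j+1) + ρ * (Dop ρ b Q).coeff j)) := by
    intro j
    have : Lop n ρ b Q = -(C 4 * (X * Dop ρ (b + 1) (Dop ρ b Q)) +
      C (2 * (n : ℝ)) * (Dop ρ b Q + C ρ * (X * Dop ρ b Q))) := by unfold Lop; ring
    rw [this, coeff_neg, coeff_add, coeff_C_mul, coeff_C_mul, coeff_add, coeff_C_mul,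
      coeff_X_mul, coeff_X_mul]
  have z1 : ∀ j, m < j → (Dop ρ b Q).coeff j = 0 := fun j hj =>
    coeff_eq_zero_of_natDegree_lt (lt_of_le_of_lt h1 hj)
  have z2 : ∀ j, m < j → (Dop ρ (b+1) (Dop ρ b Q)).coeff j = 0 := fun j hj =>
    coeff_eq_zero_of_natDegree_lt (lt_of_le_of_lt h3 hj)
  constructor
  · rw [natDegree_le_iff_coeff_eq_zero]
    intro j hj
    obtain ⟨j, rfl⟩ : ∃ i, j = i + 1 := ⟨j - 1, by omega⟩
    rw [hc, z1 _ (by omega), z1 _ (by omega), z2 _ (by omega)]; ring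
  · rw [hc, z1 _ (by omega), h4, h2]; ring

lemma rhoNK_pos (n k : ℕ) (hnk : 2 * k < n) : 0 < rhoNK n k := by
  unfold rhoNK
  apply Real.rpow_pos_of_pos
  apply Finset.prod_pos
  intro j _
  have : (2 * k : ℝ) < n := by exact_mod_cast hnk
  have : (0:ℝ) ≤ j := by positivity
  linarith

lemma iter_lap (n k : ℕ) (hnk : 2 * k < n) (m : ℕ) (hm : 2 * m < k) :
    ∃ Q : Polynomial ℝ, Q.natDegree ≤ m ∧ Q.coeff m ≠ 0 ∧
      euclLap^[m] (bubble n k) = Fqb (rhoNK n k) (((n : ℝ) - 2 * k) / 2 + 2 * m) Q := by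
  have hρ := rhoNK_pos n k hnk
  have hn : (2 * k : ℝ) < n := by exact_mod_cast hnk
  induction m with
  | zero =>
    refine ⟨1, by simp, by simp, ?_⟩
    funext y
    simp [bubble, Fqb]
  | succ m ih =>
    obtain ⟨Q, h1, h2, h3⟩ := ih (by omega)
    obtain ⟨h4, h5⟩ := Lop_deg n (rhoNK n k) (((n : ℝ) - 2 * k) / 2 + 2 * m) Q m h1
    refine ⟨_, h4, ?_, ?_⟩
    · rw [h5]
      have hm' : (2 * (m + 1) : ℝ) < k := by exact_mod_cast hm
      have hm0 : (0:ℝ) ≤ m := by positivity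
      have a1 : (m : ℝ) - (((n : ℝ) - 2 * k) / 2 + 2 * m) ≠ 0 := by linarith
      have a2 : 4 * ((m : ℝ) - (((n : ℝ) - 2 * k) / 2 + 2 * m) - 1) + 2 * n ≠ 0 := by linarith
      exact neg_ne_zero.2 (by positivity)
    · rw [Function.iterate_succ_apply', h3, euclLap_Fqb hρ]
      congr 1
      push_cast; ring

open Polynomial in
lemma comp_sq_deg (Q : Polynomial ℝ) (m : ℕ) (h1 : Q.natDegree ≤ m) (h2 : Q.coeff m ≠ 0) :
    (Q.comp (X ^ 2)).degree = ((2 * m : ℕ) : WithBot ℕ) := by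
  have hd : Q.natDegree = m := le_antisymm h1 (le_natDegree_of_ne_zero h2)
  have h0 : Q ≠ 0 := by rintro rfl; simp at h2
  have hne : Q.comp (X ^ 2) ≠ 0 := by
    rw [Ne, comp_eq_zero_iff]
    rintro (h | ⟨_, h⟩)
    · exact h0 h
    · have := congrArg natDegree h
      simp at this
  rw [degree_eq_natDegree hne, natDegree_comp, hd, natDegree_X_pow, mul_comm]

lemma poly_part (n k : ℕ) (hnk : 2 * k < n) (l : ℕ) (hl : l < k) :
      ∃ P : Polynomial ℝ, P.degree = (l : ℕ) ∧ P.leadingCoeff ≠ 0 ∧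
        ∀ y : EuclideanSpace ℝ (Fin n),
          halfLapNorm n k l y
            = |P.eval ‖y‖| * (1 + rhoNK n k * ‖y‖ ^ 2) ^ (-(((n : ℝ) - 2 * k + 2 * l) / 2)) := by
  have hρ := rhoNK_pos n k hnk
  have hn : (2 * k : ℝ) < n := by exact_mod_cast hnk
  have hlc : ∀ P : Polynomial ℝ, P.degree = (l : ℕ) → P.leadingCoeff ≠ 0 := by
    intro P hP h
    rw [Polynomial.leadingCoeff_eq_zero] at h
    subst h
    simp at hP
  rcases Nat.even_or_odd l with he | ho
  · obtain ⟨m, hm⟩ := he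
    obtain ⟨Q, h1, h2, h3⟩ := iter_lap n k hnk m (by omega)
    have hd := comp_sq_deg Q m h1 h2
    have hlm : 2 * m = l := by omega
    rw [hlm] at hd
    refine ⟨_, hd, hlc _ hd, fun y => ?_⟩
    have hp := base_pos hρ (sq_nonneg ‖y‖)
    have : l / 2 = m := by omega
    unfold halfLapNorm
    rw [if_pos ⟨m, hm⟩, this, h3]
    simp only [Fqb, abs_mul, Polynomial.eval_comp, Polynomial.eval_pow, Polynomial.eval_X]
    rw [abs_of_pos (Real.rpow_pos_of_pos hp _)]
    congr 2
    rw [← hlm]; push_cast; ring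
  · obtain ⟨m, hm⟩ := ho
    obtain ⟨Q, h1, h2, h3⟩ := iter_lap n k hnk m (by omega)
    set b := ((n : ℝ) - 2 * k) / 2 + 2 * m with hb
    obtain ⟨h4, h5⟩ := Dop_deg (rhoNK n k) b Q m h1
    have h6 : (Dop (rhoNK n k) b Q).coeff m ≠ 0 := by
      rw [h5]
      have hm0 : (0:ℝ) ≤ m := by positivity
      have a1 : (m : ℝ) - b ≠ 0 := by rw [hb]; linarith
      positivity
    have hd := comp_sq_deg _ m h4 h6
    have hd' : (Polynomial.C 2 * (Polynomial.X * (Dop (rhoNK n k) b Q).comp (Polynomial.X ^ 2))).degree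
        = ((l : ℕ) : WithBot ℕ) := by
      rw [Polynomial.degree_mul, Polynomial.degree_mul, hd, Polynomial.degree_C two_ne_zero,
        Polynomial.degree_X, hm]
      push_cast; ring
    refine ⟨_, hd', hlc _ hd', fun y => ?_⟩
    have hp := base_pos hρ (sq_nonneg ‖y‖)
    have : l / 2 = m := by omega
    unfold halfLapNorm
    rw [if_neg (by rw [Nat.not_even_iff_odd]; exact ⟨m, hm⟩), this, h3, fderiv_Fqb hρ]
    simp only [norm_smul, innerSL_apply_norm, Fqb, Real.norm_eq_abs, abs_mul, Polynomial.eval_comp,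
      Polynomial.eval_mul, Polynomial.eval_C, Polynomial.eval_pow, Polynomial.eval_X, abs_norm]
    rw [abs_of_pos (Real.rpow_pos_of_pos hp _)]
    have : -(b + 1) = -(((n : ℝ) - 2 * k + 2 * l) / 2) := by
      rw [hm, hb]; push_cast; ring
    rw [this]
    ring

def gfun (p : ℕ) (T : ℝ) : ℝ := if p = 0 then T else if p = 1 then 1 + Real.log T else 1

lemma gfun_ge_one (p : ℕ) {T : ℝ} (hT : 1 ≤ T) : 1 ≤ gfun p T := by
  have := Real.log_nonneg hT
  unfold gfun
  split_ifs <;> linarith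

lemma cont_inv_pow (p : ℕ) {R T : ℝ} (hR : 1 ≤ R) (hRT : R ≤ T) :
    IntervalIntegrable (fun r : ℝ => (r ^ p)⁻¹) volume R T := by
  apply ContinuousOn.intervalIntegrable
  rw [Set.uIcc_of_le hRT]
  apply ContinuousOn.inv₀ (by fun_prop)
  intro x hx
  have : 0 < x := by linarith [hx.1]
  positivity

lemma gfun_integral (p : ℕ) {R T : ℝ} (hR : 1 ≤ R) (hRT : R ≤ T) :
    (∫ r in R..T, (r ^ p)⁻¹) ≤ gfun p T ∧
      gfun p T ≤ (R + 1 + Real.log R) + ∫ r in R..T, (r ^ p)⁻¹ := by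
  have hl := Real.log_nonneg hR
  have hl' := Real.log_nonneg (hR.trans hRT)
  match p with
  | 0 =>
    simp [gfun]
    constructor <;> linarith
  | 1 =>
    simp only [gfun, pow_one]
    rw [integral_inv_of_pos (by linarith) (by linarith),
      Real.log_div (by linarith) (by linarith)]
    norm_num
    constructor <;> linarith
  | p + 2 =>
    have h0 : 0 ≤ ∫ r in R..T, (r ^ (p+2))⁻¹ := by
      apply intervalIntegral.integral_nonneg hRT
      intro u hu
      have : 0 < u := by linarith [hu.1]
      positivity
    have h1 : (∫ r in R..T, (r ^ (p+2))⁻¹) ≤ ∫ r in R..T, r ^ (-2 : ℤ) := by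
      apply intervalIntegral.integral_mono_on hRT (cont_inv_pow _ hR hRT)
        (by simpa using cont_inv_pow 2 hR hRT)
      intro x hx
      have hx1 : 1 ≤ x := by linarith [hx.1]
      have : x ^ (-2 : ℤ) = (x ^ 2)⁻¹ := rfl
      rw [this]
      apply inv_anti₀ (by positivity)
      exact pow_le_pow_right₀ hx1 (by omega)
    have h2 : (∫ r in R..T, r ^ (-2 : ℤ)) ≤ 1 := by
      rw [integral_zpow (Or.inr ⟨by norm_num, Set.notMem_uIcc_of_lt (by linarith) (by linarith)⟩)]
      norm_num
      have : R⁻¹ ≤ 1 := inv_le_one_of_one_le₀ hR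
      have : 0 < T⁻¹ := inv_pos.2 (by linarith)
      linarith
    have hg : gfun (p+2) T = 1 := by simp [gfun]
    rw [hg]
    constructor <;> linarith

open Filter Topology in
lemma growth (ψ : ℝ → ℝ) (p : ℕ) (L : ℝ) (hc : Continuous ψ) (h0 : ∀ r, 0 ≤ r → 0 ≤ ψ r)
    (hpos : ∃ c ∈ Set.Icc (0:ℝ) 2, 0 < ψ c) (hL : 0 < L)
    (hlim : Tendsto (fun r => ψ r * r ^ p) atTop (𝓝 L)) :
    ∃ a A : ℝ, 0 < a ∧ 0 < A ∧ ∀ T, 2 ≤ T →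
      a * gfun p T ≤ (∫ r in (0:ℝ)..T, ψ r) ∧ (∫ r in (0:ℝ)..T, ψ r) ≤ A * gfun p T := by
  have hii : ∀ a b, IntervalIntegrable ψ volume a b := fun a b => hc.intervalIntegrable a b
  have e1 : ∀ᶠ r in atTop, L / 2 < ψ r * r ^ p := hlim.eventually_const_lt (by linarith)
  have e2 : ∀ᶠ r in atTop, ψ r * r ^ p < 2 * L := hlim.eventually_lt_const (by linarith)
  obtain ⟨R, hR⟩ := eventually_atTop.1 ((e1.and e2).and (eventually_ge_atTop (2:ℝ)))
  have hR2 : 2 ≤ R := (hR R le_rfl).2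
  have hlR := Real.log_nonneg (show 1 ≤ R by linarith)
  set K := R + 1 + Real.log R with hK
  have hmono : ∀ s t, 0 ≤ s → s ≤ t → (∫ r in (0:ℝ)..s, ψ r) ≤ ∫ r in (0:ℝ)..t, ψ r := by
    intro s t hs hst
    rw [← intervalIntegral.integral_add_adjacent_intervals (hii 0 s) (hii s t)]
    have := intervalIntegral.integral_nonneg (μ := volume) hst
      (fun u hu => h0 u (hs.trans hu.1))
    linarith
  set δ := ∫ r in (0:ℝ)..2, ψ r with hδ
  have hδ0 : 0 < δ := intervalIntegral.integral_pos (by norm_num) hc.continuousOn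
    (fun x hx => h0 x hx.1.le) hpos
  set M := ∫ r in (0:ℝ)..R, ψ r with hM
  have hM0 : 0 < M := lt_of_lt_of_le hδ0 (hmono 2 R (by norm_num) hR2)
  -- the main two-sided bound beyond R
  have hbig : ∀ T, R ≤ T → L / 2 * (∫ r in R..T, (r ^ p)⁻¹) ≤ (∫ r in R..T, ψ r) ∧
      (∫ r in R..T, ψ r) ≤ 2 * L * (∫ r in R..T, (r ^ p)⁻¹) := by
    intro T hT
    have hci := cont_inv_pow p (show 1 ≤ R by linarith) hT
    rw [← intervalIntegral.integral_const_mul, ← intervalIntegral.integral_const_mul]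
    constructor
    · apply intervalIntegral.integral_mono_on hT (hci.const_mul _) (hii _ _)
      intro x hx
      have hx0 : 0 < x := by linarith [hx.1]
      rw [← div_eq_mul_inv, div_le_iff₀ (by positivity)]
      exact (hR x hx.1).1.1.le
    · apply intervalIntegral.integral_mono_on hT (hii _ _) (hci.const_mul _)
      intro x hx
      have hx0 : 0 < x := by linarith [hx.1]
      rw [← div_eq_mul_inv, le_div_iff₀ (by positivity)]
      exact (hR x hx.1).1.2.le
  have hgK : ∀ T, 2 ≤ T → T ≤ R → gfun p T ≤ K := by
    intro T h1 h2
    have := Real.log_le_log (by linarith) h2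
    unfold gfun
    split_ifs <;> linarith
  refine ⟨(2 / L + K / δ)⁻¹, M + 2 * L, by positivity, by positivity, fun T hT => ?_⟩
  have hg1 := gfun_ge_one p (show 1 ≤ T by linarith)
  have hIδ := hmono 2 T (by norm_num) hT
  set I := ∫ r in (0:ℝ)..T, ψ r with hI
  have hI0 : 0 < I := lt_of_lt_of_le hδ0 hIδ
  constructor
  · rw [inv_mul_le_iff₀ (by positivity)]
    have hKI : K ≤ K / δ * I := by
      rw [div_mul_eq_mul_div, le_div_iff₀ hδ0]
      exact mul_le_mul_of_nonneg_left hIδ (by positivity)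
    have hLI : 0 < 2 / L * I := by positivity
    rw [add_mul]
    rcases le_total T R with h | h
    · linarith [hgK T hT h]
    · have h3 := (gfun_integral p (show 1 ≤ R by linarith) h).2
      have h4 := (hbig T h).1
      have h5 : (∫ r in R..T, ψ r) ≤ I := by
        rw [hI, ← intervalIntegral.integral_add_adjacent_intervals (hii 0 R) (hii R T)]
        linarith
      have h6 : (∫ r in R..T, (r ^ p)⁻¹) ≤ 2 / L * I := by
        rw [div_mul_eq_mul_div, le_div_iff₀ hL]
        linarith
      linarith
  · rcases le_total T R with h | h
    · have := hmono T R (by linarith) h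
      nlinarith
    · have h3 := (gfun_integral p (show 1 ≤ R by linarith) h).1
      have h4 := (hbig T h).2
      rw [hI, ← intervalIntegral.integral_add_adjacent_intervals (hii 0 R) (hii R T)]
      nlinarith

lemma ball_integral (n : ℕ) (hn : 0 < n) (φ : ℝ → ℝ) (T : ℝ) (hT : 0 ≤ T) :
    (∫ y in Metric.ball (0 : EuclideanSpace ℝ (Fin n)) T, φ ‖y‖) =
      (n * volume.real (Metric.ball (0 : EuclideanSpace ℝ (Fin n)) 1)) *
        ∫ r in (0:ℝ)..T, r ^ (n - 1) * φ r := by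
  haveI : Nonempty (Fin n) := ⟨⟨0, hn⟩⟩
  have h := integral_fun_norm_addHaar (volume : Measure (EuclideanSpace ℝ (Fin n)))
    ((Set.Iio T).indicator φ)
  rw [← integral_indicator measurableSet_ball]
  have e : (Metric.ball (0 : EuclideanSpace ℝ (Fin n)) T).indicator (fun y => φ ‖y‖)
      = fun y => (Set.Iio T).indicator φ ‖y‖ := by
    funext y
    by_cases hy : ‖y‖ < T <;> simp [Set.indicator, hy]
  rw [e, h]
  simp only [finrank_euclideanSpace, Fintype.card_fin, nsmul_eq_mul, smul_eq_mul]
  rw [mul_assoc]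
  congr 2
  have e2 : (fun y => y ^ (n - 1) * (Set.Iio T).indicator φ y)
      = (Set.Iio T).indicator (fun y => y ^ (n - 1) * φ y) := by
    funext y
    by_cases hy : y < T <;> simp [Set.indicator_apply, hy]
  rw [e2, setIntegral_indicator measurableSet_Iio, intervalIntegral.integral_of_le hT,
    Set.Ioi_inter_Iio, integral_Ioc_eq_integral_Ioo]

open Filter Topology in
lemma energy_part (n k : ℕ) (hk : 1 ≤ k) (hnk : 2 * k < n) :
    ∃ a A : ℝ, 0 < a ∧ 0 < A ∧ ∀ T : ℝ, 2 ≤ T →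
      a * gfun (n - 2 * k - 1) T ≤ (∫ y in Metric.ball (0 : EuclideanSpace ℝ (Fin n)) T,
              halfLapNorm n k (k - 1) y ^ 2) ∧
        (∫ y in Metric.ball (0 : EuclideanSpace ℝ (Fin n)) T,
            halfLapNorm n k (k - 1) y ^ 2) ≤ A * gfun (n - 2 * k - 1) T := by
  have hρ := rhoNK_pos n k hnk
  set ρ := rhoNK n k with hρd
  obtain ⟨P, hdeg, hlc, hP⟩ := poly_part n k hnk (k - 1) (by omega)
  have hP0 : P ≠ 0 := by rintro rfl; simp at hlc
  set φ : ℝ → ℝ := fun r => P.eval r ^ 2 / (1 + ρ * r ^ 2) ^ (n - 2) with hφ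
  have hsq : ∀ y : EuclideanSpace ℝ (Fin n), halfLapNorm n k (k - 1) y ^ 2 = φ ‖y‖ := by
    intro y
    have hp := base_pos hρ (sq_nonneg ‖y‖)
    rw [hP, mul_pow, sq_abs, hφ, ← hρd]
    simp only
    rw [div_eq_mul_inv]
    congr 1
    generalize 1 + ρ * ‖y‖ ^ 2 = t at hp
    rw [← Real.rpow_natCast t (n - 2), ← Real.rpow_neg hp.le, ← Real.rpow_mul_natCast hp.le]
    congr 1
    rw [Nat.cast_sub hk, Nat.cast_sub (show 2 ≤ n by omega)]
    push_cast; ring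
  simp only [hsq]
  set ψ : ℝ → ℝ := fun r => r ^ (n - 1) * φ r with hψ
  have hden : ∀ r : ℝ, 0 < 1 + ρ * r ^ 2 := fun r => base_pos hρ (sq_nonneg r)
  have hφc : Continuous φ := by
    apply Continuous.div (by fun_prop) (by fun_prop)
    intro r
    exact (pow_pos (hden r) _).ne'
  obtain ⟨c, hc, hcP⟩ : ∃ c ∈ Set.Ioo (0:ℝ) 2, P.eval c ≠ 0 := by
    by_contra! h
    exact hP0 (Polynomial.eq_zero_of_infinite_isRoot P
      ((Set.Ioo_infinite (by norm_num : (0:ℝ) < 2)).mono fun x hx => h x hx))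
  set N : Polynomial ℝ := Polynomial.X ^ (n - 1 + (n - 2 * k - 1)) * P ^ 2 with hN
  set D : Polynomial ℝ := (Polynomial.C ρ * Polynomial.X ^ 2 + Polynomial.C 1) ^ (n - 2) with hD
  have hd0 : (Polynomial.C ρ * Polynomial.X ^ 2 + Polynomial.C 1 : Polynomial ℝ).degree
      = ((2 : ℕ) : WithBot ℕ) := by
    rw [Polynomial.degree_add_C]
    · exact Polynomial.degree_C_mul_X_pow 2 hρ.ne'
    · rw [Polynomial.degree_C_mul_X_pow 2 hρ.ne']; norm_num
  have hl0 : (Polynomial.C ρ * Polynomial.X ^ 2 + Polynomial.C 1 : Polynomial ℝ).leadingCoeff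
      = ρ := by
    rw [Polynomial.leadingCoeff, Polynomial.natDegree_eq_of_degree_eq_some hd0]
    simp [Polynomial.coeff_one]
  have hdegeq : N.degree = D.degree := by
    rw [hN, hD, Polynomial.degree_mul, Polynomial.degree_pow, Polynomial.degree_pow,
      Polynomial.degree_pow, hd0, hdeg, Polynomial.degree_X]
    simp only [nsmul_eq_mul]
    norm_cast
    simp only [mul_one]
    omega
  have hlim := Polynomial.div_tendsto_atTop_leadingCoeff_div_of_degree_eq N D hdegeq
  have hLpos : 0 < N.leadingCoeff / D.leadingCoeff := by
    rw [hN, hD, Polynomial.leadingCoeff_mul, Polynomial.leadingCoeff_pow,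
      Polynomial.leadingCoeff_pow, Polynomial.leadingCoeff_pow, hl0, Polynomial.leadingCoeff_X]
    positivity
  obtain ⟨a, A, ha, hA, hT⟩ := growth ψ (n - 2 * k - 1) _ (by fun_prop)
    (fun r hr => by
      have := hden r
      simp only [hψ, hφ]
      positivity)
    ⟨c, ⟨hc.1.le, hc.2.le⟩, by
      have := hden c
      have := hc.1
      simp only [hψ, hφ]
      positivity⟩ hLpos
    (hlim.congr fun r => by
      simp only [hN, hD, hψ, hφ, Polynomial.eval_mul, Polynomial.eval_pow, Polynomial.eval_X,
        Polynomial.eval_add, Polynomial.eval_C]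
      rw [add_comm (ρ * r ^ 2) 1, pow_add]
      ring)
  set V : ℝ := n * volume.real (Metric.ball (0 : EuclideanSpace ℝ (Fin n)) 1) with hV
  have hVpos : 0 < V := by
    have h1 : (0:ℝ) < n := by exact_mod_cast (by omega : 0 < n)
    have h2 : 0 < volume.real (Metric.ball (0 : EuclideanSpace ℝ (Fin n)) 1) :=
      ENNReal.toReal_pos (Metric.measure_ball_pos _ _ one_pos).ne' measure_ball_lt_top.ne
    positivity
  refine ⟨V * a, V * A, by positivity, by positivity, fun T h2 => ?_⟩
  obtain ⟨h3, h4⟩ := hT T h2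
  rw [ball_integral n (by omega) φ T (by linarith), ← hV, mul_assoc V, mul_assoc V]
  exact ⟨mul_le_mul_of_nonneg_left h3 hVpos.le, mul_le_mul_of_nonneg_left h4 hVpos.le⟩

theorem halfLap_bubble_polynomial_and_energy_growth (n k : ℕ) (hk : 1 ≤ k) (hnk : 2 * k < n) :
    (∀ l : ℕ, l ≤ k - 1 →
      ∃ P : Polynomial ℝ, P.degree = (l : ℕ) ∧ P.leadingCoeff ≠ 0 ∧
        ∀ y : EuclideanSpace ℝ (Fin n),
          halfLapNorm n k l y
            = |P.eval ‖y‖| * (1 + rhoNK n k * ‖y‖ ^ 2) ^ (-(((n : ℝ) - 2 * k + 2 * l) / 2))) ∧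
    (∃ C : ℝ, 1 ≤ C ∧ ∀ T : ℝ, 2 ≤ T →
      C⁻¹ * (if n = 2 * k + 1 then T else if n = 2 * k + 2 then 1 + Real.log T else 1)
          ≤ (∫ y in Metric.ball (0 : EuclideanSpace ℝ (Fin n)) T,
              halfLapNorm n k (k - 1) y ^ 2) ∧
        (∫ y in Metric.ball (0 : EuclideanSpace ℝ (Fin n)) T,
            halfLapNorm n k (k - 1) y ^ 2)
          ≤ C * (if n = 2 * k + 1 then T else if n = 2 * k + 2 then 1 + Real.log T else 1)) := by
  refine ⟨fun l hl => poly_part n k hnk l (by omega), ?_⟩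
  obtain ⟨a, A, ha, hA, h⟩ := energy_part n k hk hnk
  refine ⟨max 1 (max a⁻¹ A), le_max_left _ _, fun T hT => ?_⟩
  have hg : (if n = 2 * k + 1 then T else if n = 2 * k + 2 then 1 + Real.log T else 1)
      = gfun (n - 2 * k - 1) T := by
    unfold gfun
    have e1 : n = 2 * k + 1 ↔ n - 2 * k - 1 = 0 := by omega
    have e2 : n = 2 * k + 2 ↔ n - 2 * k - 1 = 1 := by omega
    simp only [e1, e2]
  rw [hg]
  have hg0 : 0 ≤ gfun (n - 2 * k - 1) T :=
    zero_le_one.trans (gfun_ge_one _ (by linarith))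
  obtain ⟨h1, h2⟩ := h T hT
  constructor
  · refine le_trans (mul_le_mul_of_nonneg_right ?_ hg0) h1
    exact inv_le_of_inv_le₀ ha ((le_max_left _ _).trans (le_max_right _ _))
  · refine le_trans h2 (mul_le_mul_of_nonneg_right ?_ hg0)
    exact (le_max_right _ _).trans (le_max_right _ _)
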